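/- arXiv:2305.18621 — 8 statements merged into one kernel-verified Lean document; each statement's English description precedes it below -/
import Mathlib

section
/- Let f be a continuously differentiable function, positive on an open set U ⊆ ℝ, and let r : J → U be twice differentiable on an open interval J ⊆ ℝ satisfying the radial geodesic equation r''(t) − (f'(r(t))/(2·f(r(t))))·(r'(t))² = 0 for all t ∈ J. Then the function t ↦ r'(t)/√(f(r(t))) is constant on J. -/
/-- If `f` is continuously differentiable and positive on an open set `U`,
and `r : J → U` is twice differentiable on an open interval `J` satisfying the radial
geodesic equation `r'' − (f'(r)/(2 f(r)))·(r')² = 0`, then `t ↦ r'(t)/√(f(r(t)))`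
is constant on `J`. -/
theorem stmt_1 (f f' : ℝ → ℝ) (hf : ∀ x, HasDerivAt f (f' x) x) (hf' : Continuous f')
    (U : Set ℝ) (hU : IsOpen U) (hfpos : ∀ x ∈ U, 0 < f x)
    (a b : ℝ) (r r' r'' : ℝ → ℝ)
    (hmem : ∀ t ∈ Set.Ioo a b, r t ∈ U)
    (hr : ∀ t ∈ Set.Ioo a b, HasDerivAt r (r' t) t)
    (hr' : ∀ t ∈ Set.Ioo a b, HasDerivAt r' (r'' t) t)
    (heq : ∀ t ∈ Set.Ioo a b,
      r'' t - (f' (r t) / (2 * f (r t))) * (r' t) ^ 2 = 0) :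
    ∃ c : ℝ, ∀ t ∈ Set.Ioo a b, r' t / Real.sqrt (f (r t)) = c := by
  have hd : ∀ t ∈ Set.Ioo a b, HasDerivAt (fun t => r' t / Real.sqrt (f (r t))) 0 t := by
    intro t ht
    have hp := hfpos _ (hmem t ht)
    have h1 : HasDerivAt (fun t => f (r t)) (f' (r t) * r' t) t :=
      (hf (r t)).comp t (hr t ht)
    have hs : 0 < Real.sqrt (f (r t)) := Real.sqrt_pos.mpr hp
    have h2 := (hr' t ht).div (h1.sqrt hp.ne') hs.ne'
    refine h2.congr_deriv ?_
    have e : r'' t = (f' (r t) / (2 * f (r t))) * (r' t) ^ 2 := sub_eq_zero.mp (heq t ht)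
    have hq : f (r t) = Real.sqrt (f (r t)) ^ 2 := (Real.sq_sqrt hp.le).symm
    rw [e]
    generalize Real.sqrt (f (r t)) = s at *
    rw [hq]
    field_simp
    ring
  rcases Set.eq_empty_or_nonempty (Set.Ioo a b) with h | ⟨t0, h0⟩
  · exact ⟨0, fun t ht => by simp [h] at ht⟩
  · refine ⟨r' t0 / Real.sqrt (f (r t0)), fun t ht => ?_⟩
    exact isOpen_Ioo.is_const_of_deriv_eq_zero isPreconnected_Ioo
      (fun x hx => (hd x hx).differentiableAt.differentiableWithinAt)
      (fun x hx => (hd x hx).deriv) ht h0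
end

section
/- Fix an integer n ≥ 2, a real B > 0, set A = −((n−2)/2)·√(B/(n−1)), f(r) = 1 − 2A/r² − B/r⁴ and r₀ = (B/(n−1))^{1/4}. Let ε ∈ {−1, 1}, r₁ ≠ 0 and t₁ ∈ ℝ. For r > r₀ define α(r) = arcsin √(1 − r₀²/r²), k² = 1 − 1/n, and t(r) = t₁ + (ε/r₁)·[ √(r⁴ + (n−2)·r₀²·r² − B)/r − √n·r₀·E(α(r), k²) + (r₀/√n)·F(α(r), k²) ]. Then t is differentiable on (r₀, ∞) with t'(r) = ε/(r₁·√(f(r))) for all r > r₀, and t(r) → t₁ as r → r₀⁺. (This is the geodesic of the scalar-flat metric of Eguchi–Hanson type with θ, φ, ψ constant, passing through the removable singularity r₀.) -/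
/-- Incomplete elliptic integral of the first kind. -/
noncomputable def ellF (a k2 : ℝ) : ℝ :=
  ∫ ρ in (0:ℝ)..a, 1 / Real.sqrt (1 - k2 * Real.sin ρ ^ 2)

/-- Incomplete elliptic integral of the second kind. -/
noncomputable def ellE (a k2 : ℝ) : ℝ :=
  ∫ ρ in (0:ℝ)..a, Real.sqrt (1 - k2 * Real.sin ρ ^ 2)

lemma ell_pos (n : ℕ) (hn : 2 ≤ n) (x : ℝ) : 0 < 1 - (1 - 1 / (n : ℝ)) * Real.sin x ^ 2 := by
  have h2 : (2:ℝ) ≤ n := by exact_mod_cast hn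
  have h3 : 0 < 1 / (n : ℝ) := by positivity
  have h4 : 1 / (n : ℝ) ≤ 1 := by
    rw [div_le_one (by linarith)]; linarith
  nlinarith [Real.sin_sq_le_one x, sq_nonneg (Real.sin x)]

lemma ellF_deriv (n : ℕ) (hn : 2 ≤ n) (x : ℝ) :
    HasDerivAt (fun a => ellF a (1 - 1 / (n : ℝ)))
      (1 / Real.sqrt (1 - (1 - 1 / (n : ℝ)) * Real.sin x ^ 2)) x := by
  have hc : Continuous (fun ρ : ℝ => 1 / Real.sqrt (1 - (1 - 1 / (n : ℝ)) * Real.sin ρ ^ 2)) := by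
    refine Continuous.div continuous_const (by fun_prop) ?_
    intro y
    exact (Real.sqrt_pos.2 (ell_pos n hn y)).ne'
  exact intervalIntegral.integral_hasDerivAt_right (hc.intervalIntegrable _ _)
    (hc.stronglyMeasurableAtFilter _ _) hc.continuousAt

lemma ellE_deriv (n : ℕ) (x : ℝ) :
    HasDerivAt (fun a => ellE a (1 - 1 / (n : ℝ)))
      (Real.sqrt (1 - (1 - 1 / (n : ℝ)) * Real.sin x ^ 2)) x := by
  have hc : Continuous (fun ρ : ℝ => Real.sqrt (1 - (1 - 1 / (n : ℝ)) * Real.sin ρ ^ 2)) := by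
    fun_prop
  exact intervalIntegral.integral_hasDerivAt_right (hc.intervalIntegrable _ _)
    (hc.stronglyMeasurableAtFilter _ _) hc.continuousAt

/-- geodesics of the scalar-flat metrics of Eguchi–Hanson type with
constant `θ, φ, ψ`, passing through the removable singularity `r₀`. -/
theorem stmt_2 (n : ℕ) (hn : 2 ≤ n) (B : ℝ) (hB : 0 < B)
    (A r₀ : ℝ)
    (hA : A = -(((n : ℝ) - 2) / 2) * Real.sqrt (B / ((n : ℝ) - 1)))
    (hr₀ : r₀ = (B / ((n : ℝ) - 1)) ^ ((1 : ℝ) / 4))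
    (f : ℝ → ℝ) (hf : ∀ r, f r = 1 - 2 * A / r ^ 2 - B / r ^ 4)
    (ε : ℝ) (hε : ε = 1 ∨ ε = -1) (r₁ : ℝ) (hr₁ : r₁ ≠ 0) (t₁ : ℝ)
    (α : ℝ → ℝ) (hα : ∀ r, α r = Real.arcsin (Real.sqrt (1 - r₀ ^ 2 / r ^ 2)))
    (k2 : ℝ) (hk2 : k2 = 1 - 1 / (n : ℝ))
    (t : ℝ → ℝ)
    (ht : ∀ r, t r = t₁ + (ε / r₁) *
      (Real.sqrt (r ^ 4 + ((n : ℝ) - 2) * r₀ ^ 2 * r ^ 2 - B) / r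
        - Real.sqrt (n : ℝ) * r₀ * ellE (α r) k2
        + (r₀ / Real.sqrt (n : ℝ)) * ellF (α r) k2)) :
    (∀ r, r₀ < r → HasDerivAt t (ε / (r₁ * Real.sqrt (f r))) r)
    ∧ Filter.Tendsto t (nhdsWithin r₀ (Set.Ioi r₀)) (nhds t₁) := by
  have h2 : (2:ℝ) ≤ n := by exact_mod_cast hn
  have hq : 0 < B / ((n : ℝ) - 1) := div_pos hB (by linarith)
  have hr0 : 0 < r₀ := by rw [hr₀]; exact Real.rpow_pos_of_pos hq _
  have h4 : r₀ ^ 4 = B / ((n : ℝ) - 1) := by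
    rw [hr₀, ← Real.rpow_natCast, ← Real.rpow_mul hq.le]; norm_num
  have hsq : Real.sqrt (B / ((n : ℝ) - 1)) = r₀ ^ 2 := by
    rw [← h4, show r₀ ^ 4 = (r₀ ^ 2) ^ 2 by ring, Real.sqrt_sq (by positivity)]
  have hBe : B = ((n : ℝ) - 1) * r₀ ^ 4 := by
    rw [h4]; field_simp [show (n : ℝ) - 1 ≠ 0 by linarith]
  rw [hsq] at hA
  clear hr₀ hsq h4 hq
  have htf : t = fun r => t₁ + (ε / r₁) *
      (Real.sqrt (r ^ 4 + ((n : ℝ) - 2) * r₀ ^ 2 * r ^ 2 - B) / r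
        - Real.sqrt (n : ℝ) * r₀ * ellE (α r) k2
        + (r₀ / Real.sqrt (n : ℝ)) * ellF (α r) k2) := funext ht
  have hαf : α = fun r => Real.arcsin (Real.sqrt (1 - r₀ ^ 2 / r ^ 2)) := funext hα
  subst hk2
  constructor
  · intro r hr
    have hrp : 0 < r := hr0.trans hr
    have hSS : 0 < r ^ 2 - r₀ ^ 2 := by nlinarith
    have hTT : 0 < r ^ 2 + ((n : ℝ) - 1) * r₀ ^ 2 := by
      have : 0 < ((n : ℝ) - 1) * r₀ ^ 2 := mul_pos (by linarith) (by positivity)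
      positivity
    obtain ⟨S, hS⟩ : ∃ S, S = Real.sqrt (r ^ 2 - r₀ ^ 2) := ⟨_, rfl⟩
    obtain ⟨T, hT⟩ : ∃ T, T = Real.sqrt (r ^ 2 + ((n : ℝ) - 1) * r₀ ^ 2) := ⟨_, rfl⟩
    obtain ⟨N, hN⟩ : ∃ N, N = Real.sqrt (n : ℝ) := ⟨_, rfl⟩
    have hSp : 0 < S := by rw [hS]; exact Real.sqrt_pos.2 hSS
    have hTp : 0 < T := by rw [hT]; exact Real.sqrt_pos.2 hTT
    have hNp : 0 < N := by rw [hN]; exact Real.sqrt_pos.2 (by linarith)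
    have hS2 : S ^ 2 = r ^ 2 - r₀ ^ 2 := by rw [hS]; exact Real.sq_sqrt hSS.le
    have hT2 : T ^ 2 = r ^ 2 + ((n : ℝ) - 1) * r₀ ^ 2 := by rw [hT]; exact Real.sq_sqrt hTT.le
    have hN2 : N ^ 2 = n := by rw [hN]; exact Real.sq_sqrt (by linarith)
    have eP : r ^ 4 + ((n : ℝ) - 2) * r₀ ^ 2 * r ^ 2 - B = (S * T) ^ 2 := by
      rw [mul_pow, hS2, hT2, hBe]; ring
    have e1 : Real.sqrt (r ^ 4 + ((n : ℝ) - 2) * r₀ ^ 2 * r ^ 2 - B) = S * T := by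
      rw [eP, Real.sqrt_sq (by positivity)]
    have eQ : 1 - r₀ ^ 2 / r ^ 2 = (S / r) ^ 2 := by
      rw [div_pow, hS2]; field_simp
    have e2 : Real.sqrt (1 - r₀ ^ 2 / r ^ 2) = S / r := by
      rw [eQ, Real.sqrt_sq (by positivity)]
    have eF : f r = (S * T / r ^ 2) ^ 2 := by
      rw [div_pow, ← eP, hf, hA]; field_simp; ring
    have e3 : Real.sqrt (f r) = S * T / r ^ 2 := by
      rw [eF, Real.sqrt_sq (by positivity)]
    have hlt : S / r < 1 := by
      rw [div_lt_one hrp]; nlinarith [sq_nonneg r₀, pow_pos hr0 2]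
    have hgt : -1 < S / r := by
      have : 0 < S / r := by positivity
      linarith
    have esin : Real.sin (α r) = S / r := by
      rw [hα, e2, Real.sin_arcsin hgt.le hlt.le]
    have eK : 1 - (1 - 1 / (n : ℝ)) * Real.sin (α r) ^ 2 = (T / (N * r)) ^ 2 := by
      rw [esin, div_pow, div_pow, mul_pow, hS2, hT2, hN2]
      field_simp; ring
    have e4 : Real.sqrt (1 - (1 - 1 / (n : ℝ)) * Real.sin (α r) ^ 2) = T / (N * r) := by
      rw [eK, Real.sqrt_sq (by positivity)]
    have e5 : Real.sqrt (1 - (S / r) ^ 2) = r₀ / r := by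
      rw [← eQ, show 1 - (1 - r₀ ^ 2 / r ^ 2) = (r₀ / r) ^ 2 by ring,
        Real.sqrt_sq (by positivity)]
    -- derivative of alpha
    have d1 : HasDerivAt (fun r : ℝ => 1 - r₀ ^ 2 / r ^ 2) (2 * r₀ ^ 2 / r ^ 3) r := by
      have := ((hasDerivAt_const r (r₀ ^ 2)).div (hasDerivAt_pow 2 r) (by positivity)).const_sub 1
      refine HasDerivAt.congr_deriv this ?_
      norm_num
      field_simp
    have d2 := d1.sqrt (by rw [eQ]; positivity)
    rw [e2] at d2
    have d3 : HasDerivAt α (r₀ / (r * S)) r := by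
      have h := (Real.hasDerivAt_arcsin (x := Real.sqrt (1 - r₀ ^ 2 / r ^ 2))
        (by rw [e2]; exact hgt.ne') (by rw [e2]; exact hlt.ne)).comp r d2
      rw [e2, e5] at h
      rw [hαf]
      refine HasDerivAt.congr_deriv h ?_
      field_simp
    have dE := (ellE_deriv n (α r)).comp r d3
    have dF := (ellF_deriv n hn (α r)).comp r d3
    rw [e4] at dE dF
    have d4 : HasDerivAt (fun r : ℝ => r ^ 4 + ((n : ℝ) - 2) * r₀ ^ 2 * r ^ 2 - B)
        (4 * r ^ 3 + ((n : ℝ) - 2) * r₀ ^ 2 * (2 * r)) r := by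
      have := ((hasDerivAt_pow 4 r).add
        ((hasDerivAt_pow 2 r).const_mul (((n : ℝ) - 2) * r₀ ^ 2))).sub_const B
      refine HasDerivAt.congr_deriv this ?_
      norm_num
    have d5 := (d4.sqrt (by rw [eP]; positivity)).div (hasDerivAt_id r) hrp.ne'
    have d6 := (((d5.sub (dE.const_mul (Real.sqrt (n : ℝ) * r₀))).add
      (dF.const_mul (r₀ / Real.sqrt (n : ℝ)))).const_mul (ε / r₁)).const_add t₁
    rw [htf]
    refine d6.congr_deriv ?_
    simp only [id]
    rw [e1, e3, ← hN]
    have key : 4 * r ^ 3 + ((n : ℝ) - 2) * r₀ ^ 2 * (2 * r) = 2 * r * (S ^ 2 + T ^ 2) := by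
      rw [hS2, hT2]; ring
    rw [key]
    have ha : r₀ ^ 2 = r ^ 2 - S ^ 2 := by rw [hS2]; ring
    field_simp
    ring_nf
    rw [ha]
    ring
  · have hc : ContinuousAt t r₀ := by
      have hαc : ContinuousAt α r₀ := by
        rw [hαf]
        refine Real.continuous_arcsin.continuousAt.comp (Real.continuous_sqrt.continuousAt.comp ?_)
        exact continuousAt_const.sub (continuousAt_const.div (by fun_prop) (by positivity))
      have cE : ContinuousAt (fun r => ellE (α r) (1 - 1 / (n : ℝ))) r₀ :=
        ContinuousAt.comp (f := α) (ellE_deriv n (α r₀)).continuousAt hαc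
      have cF : ContinuousAt (fun r => ellF (α r) (1 - 1 / (n : ℝ))) r₀ :=
        ContinuousAt.comp (f := α) (ellF_deriv n hn (α r₀)).continuousAt hαc
      rw [htf]
      refine continuousAt_const.add (continuousAt_const.mul (((ContinuousAt.div ?_ continuousAt_id hr0.ne').sub
        (continuousAt_const.mul cE)).add (continuousAt_const.mul cF)))
      fun_prop
    have hv : t r₀ = t₁ := by
      have h0 : α r₀ = 0 := by
        rw [hα, div_self (by positivity)]; simp
      have h1 : r₀ ^ 4 + ((n : ℝ) - 2) * r₀ ^ 2 * r₀ ^ 2 - B = 0 := by rw [hBe]; ring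
      rw [ht, h0, h1]
      simp [ellE, ellF]
    have := hc.tendsto
    rw [hv] at this
    exact this.mono_left nhdsWithin_le_nhds
end

section
/- Fix an integer n ≥ 2, a real B > 0, set r₀ = (B/(n−1))^{1/4}, and let r₁ ≠ 0 and ψ₀ be real constants. Define r₊ = (1/(2√2))·√(4(2−n)·r₀² + ψ₀²/r₁² + √((4(2−n)·r₀² + ψ₀²/r₁²)² + 64B)). Then r₊ ≥ r₀, and r₊ = r₀ if and only if ψ₀ = 0. -/
/-- the turning radius `r₊` satisfies `r₊ ≥ r₀`, with equality iff `ψ₀ = 0`. -/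
theorem stmt_7 (n : ℕ) (hn : 2 ≤ n) (B : ℝ) (hB : 0 < B)
    (r₀ : ℝ) (hr₀ : r₀ = (B / ((n : ℝ) - 1)) ^ ((1 : ℝ) / 4))
    (r₁ ψ₀ : ℝ) (hr₁ : r₁ ≠ 0)
    (rp : ℝ) (hrp : rp = (1 / (2 * Real.sqrt 2)) * Real.sqrt
      (4 * ((2:ℝ) - (n : ℝ)) * r₀ ^ 2 + ψ₀ ^ 2 / r₁ ^ 2
        + Real.sqrt ((4 * ((2:ℝ) - (n : ℝ)) * r₀ ^ 2 + ψ₀ ^ 2 / r₁ ^ 2) ^ 2 + 64 * B))) :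
    r₀ ≤ rp ∧ (rp = r₀ ↔ ψ₀ = 0) := by
  have hn' : (2:ℝ) ≤ n := by exact_mod_cast hn
  have hq : 0 < B / ((n : ℝ) - 1) := div_pos hB (by linarith)
  have h0 : 0 < r₀ := by rw [hr₀]; positivity
  have h4 : r₀ ^ 4 = B / ((n : ℝ) - 1) := by
    rw [hr₀, ← Real.rpow_natCast, ← Real.rpow_mul hq.le]
    norm_num
  have hBe : B = ((n : ℝ) - 1) * r₀ ^ 4 := by
    rw [h4]
    have : (n : ℝ) - 1 ≠ 0 := by linarith
    field_simp
  obtain ⟨p, hp⟩ : ∃ p, p = ψ₀ ^ 2 / r₁ ^ 2 := ⟨_, rfl⟩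
  have hp0 : 0 ≤ p := by rw [hp]; positivity
  have hpi : p = 0 ↔ ψ₀ = 0 := by
    rw [hp]; simp [hr₁]
  rw [← hp] at hrp
  obtain ⟨c, hc⟩ : ∃ c, c = 4 * ((2:ℝ) - (n : ℝ)) * r₀ ^ 2 + p := ⟨_, rfl⟩
  rw [← hc] at hrp
  obtain ⟨S, hS⟩ : ∃ S, S = Real.sqrt (c ^ 2 + 64 * B) := ⟨_, rfl⟩
  rw [← hS] at hrp
  have hS0 : 0 ≤ S := by rw [hS]; positivity
  have hS2 : S ^ 2 = c ^ 2 + 64 * B := by rw [hS]; exact Real.sq_sqrt (by positivity)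
  obtain ⟨X, hX⟩ : ∃ X, X = c + S := ⟨_, rfl⟩
  rw [← hX] at hrp
  have hXp : 0 < X := by
    by_contra h
    nlinarith
  have hrp0 : 0 ≤ rp := by rw [hrp]; positivity
  have hrp2 : 8 * rp ^ 2 = X := by
    rw [hrp, mul_pow, div_pow, mul_pow, Real.sq_sqrt hXp.le, Real.sq_sqrt (by norm_num)]
    ring
  have key : (X - 8 * r₀ ^ 2) * (X + 8 * ((n : ℝ) - 1) * r₀ ^ 2) = 2 * p * X := by
    have hSe : S = X - c := by linarith
    rw [hSe, hBe] at hS2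
    have hpe : p = c - 4 * ((2:ℝ) - (n : ℝ)) * r₀ ^ 2 := by linarith
    rw [hpe]
    linear_combination hS2
  have hD : 0 < X + 8 * ((n : ℝ) - 1) * r₀ ^ 2 := by
    have : 0 < (n : ℝ) - 1 := by linarith
    positivity
  have hge : 0 ≤ X - 8 * r₀ ^ 2 := by
    by_contra h
    have h1 := mul_neg_of_neg_of_pos (not_le.mp h) hD
    have h2 : 0 ≤ 2 * p * X := by positivity
    linarith
  refine ⟨(sq_le_sq₀ h0.le hrp0).mp (by linarith), ?_⟩
  rw [← hpi]
  constructor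
  · intro h
    have : X - 8 * r₀ ^ 2 = 0 := by rw [← hrp2, h]; ring
    rw [this, zero_mul] at key
    rcases mul_eq_zero.mp key.symm with h | h <;> linarith
  · intro h
    rw [h, mul_zero, zero_mul] at key
    rcases mul_eq_zero.mp key with h | h
    · have h5 : rp ^ 2 = r₀ ^ 2 := by linarith
      exact (sq_eq_sq₀ hrp0 h0.le).mp h5
    · linarith
end

section
/- Fix an integer n ≥ 2, a real B > 0, set A = −((n−2)/2)·√(B/(n−1)), f(r) = 1 − 2A/r² − B/r⁴, r₀ = (B/(n−1))^{1/4}, and g(r) = r²·f(r). Let r : J → (r₀, ∞) and ψ : J → ℝ be twice differentiable on an open interval J satisfying r'' − (f'(r)/(2·f(r)))·(r')² − (f(r)·g'(r)/8)·(ψ')² = 0 and ψ'' + (g'(r)/g(r))·r'·ψ' = 0 on J. If the infimum of r over J equals r₀ (the geodesic reaches the removable singularity), then r(t)²·f(r(t))·ψ'(t) = 0 for all t ∈ J; hence ψ is constant on J. -/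
theorem const_on_Ioo_aux (a b : ℝ) (F : ℝ → ℝ) (hF : ∀ t ∈ Set.Ioo a b, HasDerivAt F 0 t) :
    ∀ s ∈ Set.Ioo a b, ∀ t ∈ Set.Ioo a b, F s = F t := by
  intro s hs t ht
  have h := (convex_Ioo a b).norm_image_sub_le_of_norm_hasDerivWithin_le (f := F) (f' := fun _ => 0)
    (C := 0) (fun x hx => (hF x hx).hasDerivWithinAt) (by simp) hs ht
  simp only [zero_mul, norm_le_zero_iff] at h
  linarith

/-- a geodesic with constant `θ, φ` that reaches the removable singularity
(the infimum of `r` over `J` equals `r₀`) must have `r²·f(r)·ψ' = 0`, hence `ψ` constant. -/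
theorem stmt_8 (n : ℕ) (hn : 2 ≤ n) (B : ℝ) (hB : 0 < B)
    (A r₀ : ℝ)
    (hA : A = -(((n : ℝ) - 2) / 2) * Real.sqrt (B / ((n : ℝ) - 1)))
    (hr₀ : r₀ = (B / ((n : ℝ) - 1)) ^ ((1 : ℝ) / 4))
    (f : ℝ → ℝ) (hf : ∀ r, f r = 1 - 2 * A / r ^ 2 - B / r ^ 4)
    (g : ℝ → ℝ) (hg : ∀ r, g r = r ^ 2 * f r)
    (a b : ℝ) (hab : a < b) (r r' r'' ψ ψ' ψ'' : ℝ → ℝ)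
    (hrange : ∀ t ∈ Set.Ioo a b, r₀ < r t)
    (hr : ∀ t ∈ Set.Ioo a b, HasDerivAt r (r' t) t)
    (hr' : ∀ t ∈ Set.Ioo a b, HasDerivAt r' (r'' t) t)
    (hψ : ∀ t ∈ Set.Ioo a b, HasDerivAt ψ (ψ' t) t)
    (hψ' : ∀ t ∈ Set.Ioo a b, HasDerivAt ψ' (ψ'' t) t)
    (heq1 : ∀ t ∈ Set.Ioo a b,
      r'' t - (deriv f (r t) / (2 * f (r t))) * (r' t) ^ 2
        - (f (r t) * deriv g (r t) / 8) * (ψ' t) ^ 2 = 0)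
    (heq2 : ∀ t ∈ Set.Ioo a b,
      ψ'' t + (deriv g (r t) / g (r t)) * r' t * ψ' t = 0)
    (hinf : sInf (r '' Set.Ioo a b) = r₀) :
    (∀ t ∈ Set.Ioo a b, (r t) ^ 2 * f (r t) * ψ' t = 0)
    ∧ (∀ s ∈ Set.Ioo a b, ∀ t ∈ Set.Ioo a b, ψ s = ψ t) := by
  have hN : (2:ℝ) ≤ n := by exact_mod_cast hn
  set m : ℝ := Real.sqrt (B / ((n : ℝ) - 1)) with hm
  have hq : 0 < B / ((n : ℝ) - 1) := div_pos hB (by linarith)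
  have hm0 : 0 < m := Real.sqrt_pos.mpr hq
  have hmm : m ^ 2 = B / ((n : ℝ) - 1) := Real.sq_sqrt hq.le
  have hr0pos : 0 < r₀ := by rw [hr₀]; exact Real.rpow_pos_of_pos hq _
  have hr0m : r₀ ^ 2 = m := by
    rw [hr₀, hm, Real.sqrt_eq_rpow, ← Real.rpow_natCast, ← Real.rpow_mul hq.le]
    norm_num
  have hBm : B = ((n : ℝ) - 1) * m ^ 2 := by
    rw [hmm]; field_simp [show (n : ℝ) - 1 ≠ 0 by linarith]
  have hff : ∀ x, 0 < x → f x = (x ^ 2 - m) * (x ^ 2 + ((n : ℝ) - 1) * m) / x ^ 4 := by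
    intro x hx
    rw [hf, hA, hBm]; field_simp; ring
  have hfpos : ∀ x, r₀ < x → 0 < f x := by
    intro x hx
    have hx0 : 0 < x := hr0pos.trans hx
    rw [hff x hx0]
    have h1 : 0 < x ^ 2 - m := by rw [← hr0m]; nlinarith
    have h2 : 0 < x ^ 2 + ((n : ℝ) - 1) * m := by
      have : 0 < ((n : ℝ) - 1) * m := mul_pos (by linarith) hm0
      positivity
    positivity
  have hgpos : ∀ x, r₀ < x → 0 < g x := by
    intro x hx
    have hx0 : 0 < x := hr0pos.trans hx
    have := hfpos x hx
    rw [hg]; positivity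
  have hg0 : g r₀ = 0 := by rw [hg, hff _ hr0pos, hr0m]; simp
  have hfd : ∀ x, 0 < x → DifferentiableAt ℝ f x := by
    intro x hx
    have : f = fun r => 1 - 2 * A / r ^ 2 - B / r ^ 4 := funext hf
    rw [this]
    have h2 : x ^ 2 ≠ 0 := by positivity
    have h4 : x ^ 4 ≠ 0 := by positivity
    fun_prop (disch := assumption)
  have hgd : ∀ x, 0 < x → DifferentiableAt ℝ g x := by
    intro x hx
    have : g = fun r => r ^ 2 * f r := funext hg
    rw [this]
    have := hfd x hx
    fun_prop
  have hc := const_on_Ioo_aux a b (fun t => g (r t) * ψ' t) (by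
    intro t ht
    have hx := hrange t ht
    have hgr : HasDerivAt (fun t => g (r t)) (deriv g (r t) * r' t) t :=
      (hgd _ (hr0pos.trans hx)).hasDerivAt.comp t (hr t ht)
    have := hgr.mul (hψ' t ht)
    refine this.congr_deriv ?_
    have h0 := (hgpos _ hx).ne'
    have e : ψ'' t = - ((deriv g (r t) / g (r t)) * r' t * ψ' t) := by linarith [heq2 t ht]
    rw [e]; field_simp; ring)
  have hE := const_on_Ioo_aux a b (fun t => (r' t) ^ 2 / f (r t) + g (r t) * (ψ' t) ^ 2 / 4) (by
    intro t ht
    have hx := hrange t ht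
    have hgr : HasDerivAt (fun t => g (r t)) (deriv g (r t) * r' t) t :=
      (hgd _ (hr0pos.trans hx)).hasDerivAt.comp t (hr t ht)
    have hfr : HasDerivAt (fun t => f (r t)) (deriv f (r t) * r' t) t :=
      (hfd _ (hr0pos.trans hx)).hasDerivAt.comp t (hr t ht)
    have h0 := (hgpos _ hx).ne'
    have h1 := (hfpos _ hx).ne'
    have := (((hr' t ht).pow 2).div hfr h1).add ((hgr.mul ((hψ' t ht).pow 2)).div_const 4)
    refine this.congr_deriv ?_
    have e : ψ'' t = - ((deriv g (r t) / g (r t)) * r' t * ψ' t) := by linarith [heq2 t ht]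
    have e2 : r'' t = (deriv f (r t) / (2 * f (r t))) * (r' t) ^ 2
        + (f (r t) * deriv g (r t) / 8) * (ψ' t) ^ 2 := by linarith [heq1 t ht]
    simp only [Pi.pow_apply]
    rw [e, e2]; field_simp; ring)
  have hz : ∀ t ∈ Set.Ioo a b, g (r t) * ψ' t = 0 := by
    intro t ht
    by_contra hne
    set c := g (r t) * ψ' t with hcdef
    set E := (r' t) ^ 2 / f (r t) + g (r t) * (ψ' t) ^ 2 / 4 with hEdef
    have hE0 : 0 ≤ E := by
      have h0 := (hgpos _ (hrange t ht))
      have h1 := (hfpos _ (hrange t ht))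
      positivity
    have hc2 : 0 < c ^ 2 := by positivity
    have hcont : ∀ᶠ x in nhds r₀, g x < c ^ 2 / (4 * E + 1) :=
      (hgd _ hr0pos).continuousAt.eventually_lt_const (by rw [hg0]; positivity)
    obtain ⟨δ, hδ, hball⟩ := Metric.eventually_nhds_iff.mp hcont
    obtain ⟨_, ⟨s, hs, rfl⟩, hlt⟩ := exists_lt_of_csInf_lt
      (s := r '' Set.Ioo a b) (b := r₀ + δ) ⟨_, t, ht, rfl⟩ (by rw [hinf]; linarith)
    have hxs := hrange s hs
    have hgs := hball (y := r s) (by rw [Real.dist_eq, abs_lt]; constructor <;> linarith)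
    have h0 := hgpos _ hxs
    have h1 := hfpos _ hxs
    have hcs : g (r s) * ψ' s = c := hc s hs t ht
    have hEs : (r' s) ^ 2 / f (r s) + g (r s) * (ψ' s) ^ 2 / 4 = E := hE s hs t ht
    have h2 : g (r s) * (ψ' s) ^ 2 ≤ 4 * E := by
      have : 0 ≤ (r' s) ^ 2 / f (r s) := by positivity
      linarith
    have h3 : c ^ 2 ≤ g (r s) * (4 * E) := by
      rw [← hcs]
      calc (g (r s) * ψ' s) ^ 2 = g (r s) * (g (r s) * (ψ' s) ^ 2) := by ring
        _ ≤ _ := mul_le_mul_of_nonneg_left h2 h0.le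
    rw [lt_div_iff₀ (by positivity)] at hgs
    linarith
  refine ⟨fun t ht => by rw [← hg]; exact hz t ht, const_on_Ioo_aux a b ψ fun t ht => ?_⟩
  have h := (mul_eq_zero.mp (hz t ht)).resolve_left (hgpos _ (hrange t ht)).ne'
  rw [← h]; exact hψ t ht
end

section
/- Fix θ ∈ (0, π) and define T(x) = x·(27·sin²θ − 2x² − 9)/(2·(x² + 3)^{3/2}) for x ≥ 1. Then T is monotonically decreasing on [1, ∞) (indeed T'(x) = −27·((2x² − 3)·sin²θ + 1)/(2·(x² + 3)^{5/2}) ≤ 0 for all x ≥ 1), and for every x ≥ 1 one has −1 < T(x) ≤ 1; moreover T(x) = 1 holds if and only if x = 1 and θ = π/2. -/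
/-- for fixed `θ ∈ (0, π)`, the function
`T(x) = x(27 sin²θ − 2x² − 9)/(2(x²+3)^{3/2})` is monotonically decreasing on `[1, ∞)`
with the indicated derivative; `−1 < T(x) ≤ 1` for `x ≥ 1`, and
`T(x) = 1` iff `x = 1` and `θ = π/2`. -/
theorem stmt_11 (θ : ℝ) (hθ : θ ∈ Set.Ioo 0 Real.pi)
    (T : ℝ → ℝ)
    (hT : ∀ x, T x = x * (27 * Real.sin θ ^ 2 - 2 * x ^ 2 - 9)
      / (2 * (x ^ 2 + 3) ^ ((3 : ℝ) / 2))) :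
    (∀ x, 1 ≤ x → HasDerivAt T
      (-(27 * ((2 * x ^ 2 - 3) * Real.sin θ ^ 2 + 1))
        / (2 * (x ^ 2 + 3) ^ ((5 : ℝ) / 2))) x)
    ∧ (∀ x : ℝ, 1 ≤ x →
      -(27 * ((2 * x ^ 2 - 3) * Real.sin θ ^ 2 + 1))
        / (2 * (x ^ 2 + 3) ^ ((5 : ℝ) / 2)) ≤ 0)
    ∧ AntitoneOn T (Set.Ici 1)
    ∧ (∀ x, 1 ≤ x → -1 < T x ∧ T x ≤ 1)
    ∧ (∀ x, 1 ≤ x → (T x = 1 ↔ x = 1 ∧ θ = Real.pi / 2)) := by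
  obtain ⟨h0, hpi⟩ := hθ
  have hsin : 0 < Real.sin θ := Real.sin_pos_of_pos_of_lt_pi h0 hpi
  have hs0 : 0 < Real.sin θ ^ 2 := by positivity
  have hs1 : Real.sin θ ^ 2 ≤ 1 := Real.sin_sq_le_one θ
  have hsiff : Real.sin θ ^ 2 = 1 → θ = Real.pi / 2 := by
    intro h
    have hc : Real.cos θ = 0 := by
      have := Real.sin_sq_add_cos_sq θ
      have h2 : Real.cos θ ^ 2 = 0 := by linarith
      exact pow_eq_zero_iff (two_ne_zero) |>.mp h2
    apply Real.injOn_cos ⟨h0.le, hpi.le⟩ ⟨by linarith, by linarith⟩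
    rw [hc, Real.cos_pi_div_two]
  have hsiff' : θ = Real.pi / 2 → Real.sin θ ^ 2 = 1 := by
    intro h
    rw [h, Real.sin_pi_div_two]; norm_num
  generalize Real.sin θ ^ 2 = s at *
  have hder : ∀ x, 1 ≤ x → HasDerivAt T
      (-(27 * ((2 * x ^ 2 - 3) * s + 1))
        / (2 * (x ^ 2 + 3) ^ ((5 : ℝ) / 2))) x := by
    intro x hx
    have hp : 0 < x ^ 2 + 3 := by positivity
    have e : T = fun x => x * (27 * s - 2 * x ^ 2 - 9)
      / (2 * (x ^ 2 + 3) ^ ((3 : ℝ) / 2)) := funext hT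
    rw [e]
    have hD : HasDerivAt (fun x : ℝ => x ^ 2 + 3) (2 * x) x := by
      simpa using (hasDerivAt_pow 2 x).add_const 3
    have hP := (hD.rpow_const (p := (3:ℝ)/2) (Or.inl hp.ne')).const_mul 2
    have hN : HasDerivAt (fun x : ℝ => x * (27 * s - 2 * x ^ 2 - 9)) (27 * s - 9 - 6 * x ^ 2) x := by
      have h := (hasDerivAt_id x).mul ((((hasDerivAt_pow 2 x).const_mul 2).const_sub (27 * s)).sub_const 9)
      refine h.congr_deriv ?_
      simp
      ring
    have h3 : (0:ℝ) < (x ^ 2 + 3) ^ ((3 : ℝ) / 2) := Real.rpow_pos_of_pos hp _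
    refine (hN.div hP (by positivity)).congr_deriv ?_
    have e1 : (x ^ 2 + 3) ^ ((3 : ℝ) / 2 - 1) = (x ^ 2 + 3) ^ ((3 : ℝ) / 2) / (x ^ 2 + 3) := by
      rw [Real.rpow_sub_one hp.ne']
    have e2 : (x ^ 2 + 3) ^ ((5 : ℝ) / 2) = (x ^ 2 + 3) ^ ((3 : ℝ) / 2) * (x ^ 2 + 3) := by
      rw [← Real.rpow_add_one hp.ne']; norm_num
    rw [e1, e2]
    generalize (x ^ 2 + 3) ^ ((3 : ℝ) / 2) = P at *
    field_simp
    ring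
  have hneg : ∀ x : ℝ, 1 ≤ x →
      -(27 * ((2 * x ^ 2 - 3) * s + 1))
        / (2 * (x ^ 2 + 3) ^ ((5 : ℝ) / 2)) ≤ 0 := by
    intro x hx
    apply div_nonpos_of_nonpos_of_nonneg
    · nlinarith [mul_nonneg hs0.le (by nlinarith : 0 ≤ x ^ 2 - 1)]
    · positivity
  have hQ : ∀ x : ℝ, 1 ≤ x → ((x ^ 2 + 3) ^ ((3 : ℝ) / 2)) ^ 2 = (x ^ 2 + 3) ^ 3 := by
    intro x hx
    rw [← Real.rpow_natCast, ← Real.rpow_mul (by positivity), ← Real.rpow_natCast]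
    norm_num
  have hle : ∀ x : ℝ, 1 ≤ x → x * (9 - x ^ 2) ≤ (x ^ 2 + 3) ^ ((3 : ℝ) / 2) := by
    intro x hx
    refine le_of_abs_le (abs_le_of_sq_le_sq ?_ (by positivity))
    rw [hQ x hx]
    nlinarith [sq_nonneg (x ^ 2 - 1)]
  refine ⟨hder, hneg, ?_, ?_, ?_⟩
  · apply antitoneOn_of_deriv_nonpos (convex_Ici 1)
    · exact fun x hx => (hder x hx).continuousAt.continuousWithinAt
    · intro x hx
      rw [interior_Ici] at hx
      exact (hder x (le_of_lt hx)).differentiableAt.differentiableWithinAt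
    · intro x hx
      rw [interior_Ici] at hx
      rw [(hder x (le_of_lt hx)).deriv]
      exact hneg x (le_of_lt hx)
  · intro x hx
    have h3 : (0:ℝ) < (x ^ 2 + 3) ^ ((3 : ℝ) / 2) := by positivity
    have hq := hQ x hx
    have hl := hle x hx
    rw [hT]
    generalize (x ^ 2 + 3) ^ ((3 : ℝ) / 2) = P at *
    constructor
    · rw [lt_div_iff₀ (by positivity)]
      have : x * (2 * x ^ 2 + 9) ≤ 2 * P := by
        refine le_of_abs_le (abs_le_of_sq_le_sq ?_ (by positivity))
        nlinarith [sq_nonneg x]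
      nlinarith [mul_pos (by linarith : 0 < x) hs0]
    · rw [div_le_one (by positivity)]
      nlinarith [mul_nonneg (by linarith : 0 ≤ x) (sub_nonneg.2 hs1)]
  · intro x hx
    have h3 : (0:ℝ) < (x ^ 2 + 3) ^ ((3 : ℝ) / 2) := by positivity
    have hq := hQ x hx
    have hl := hle x hx
    rw [hT]
    generalize (x ^ 2 + 3) ^ ((3 : ℝ) / 2) = P at *
    rw [div_eq_one_iff_eq (by positivity)]
    constructor
    · intro h
      have hx0 : 0 < x := by linarith
      have hm : x * (1 - s) = 0 := by
        have := mul_nonneg hx0.le (sub_nonneg.2 hs1)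
        nlinarith
      have hs : s = 1 := by
        rcases mul_eq_zero.1 hm with h | h <;> linarith
      refine ⟨?_, hsiff hs⟩
      have hP : P = x * (9 - x ^ 2) := by subst hs; linarith
      have h2 : (x ^ 2 - 1) ^ 2 = 0 := by rw [hP] at hq; nlinarith
      have h4 : x ^ 2 - 1 = 0 := pow_eq_zero_iff two_ne_zero |>.mp h2
      nlinarith
    · rintro ⟨rfl, h⟩
      have := hsiff' h
      subst this
      nlinarith
end

section
/- Let B > 0, r₁ ≠ 0, θ ∈ (0, π), and let φ₀ be a real constant with |φ₀| ≥ 2|r₁|/B^{1/4}. Define T = √B·φ₀²·(216·r₁⁴·sin²θ − B·φ₀⁴ − 72·r₁⁴)/√((B·φ₀⁴ + 48·r₁⁴)³) (which lies in (−1, 1]), η = arccos T ∈ [0, π), and r̄₀ = (1/(2√3))·√(B·φ₀²/r₁² − 2·√(B²·φ₀⁴/r₁⁴ + 48B)·cos(η/3 + 2π/3)). Then r̄₀ ≥ B^{1/4}, and equality r̄₀ = B^{1/4} holds if and only if |φ₀| = 2|r₁|/B^{1/4} and θ = π/2. -/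
theorem le_of_sq_le_sq_aux {a b : ℝ} (hb : 0 ≤ b) (h : a ^ 2 ≤ b ^ 2) : a ≤ b :=
  (abs_le.mp (abs_le_of_sq_le_sq h hb)).2

theorem core_aux (c s T η x R v : ℝ) (hc : 1 ≤ c) (hs : 0 < s) (hs1 : s ≤ 1)
    (hR : R = Real.sqrt (c ^ 2 + 3))
    (hT : T = c * (27 * s ^ 2 - 2 * c ^ 2 - 9) / (2 * R ^ 3))
    (hη : η = Real.arccos T) (hx : x = - Real.cos (η / 3 + 2 * Real.pi / 3))
    (hv : v = (c + 2 * R * x) / 3) :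
    (-1 < T ∧ T ≤ 1) ∧ (0 ≤ η ∧ η < Real.pi) ∧ 1 ≤ v ∧ (v = 1 ↔ c = 1 ∧ s = 1) := by
  have hR2 : R ^ 2 = c ^ 2 + 3 := by rw [hR]; exact Real.sq_sqrt (by positivity)
  have hR0 : 0 < R := by rw [hR]; exact Real.sqrt_pos.mpr (by positivity)
  have hR3 : 0 < R ^ 3 := by positivity
  have hR6 : (R ^ 3) ^ 2 = (c ^ 2 + 3) ^ 3 := by rw [← hR2]; ring
  have hs2 : 0 < s ^ 2 := by positivity
  have hs21 : s ^ 2 ≤ 1 := by nlinarith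
  have hRge : 2 ≤ R := by nlinarith
  have hT1 : T ≤ 1 := by
    rw [hT, div_le_one (by positivity)]
    have h1 : c * (9 - c ^ 2) ≤ R ^ 3 := by
      apply le_of_sq_le_sq_aux hR3.le
      rw [hR6]; nlinarith [sq_nonneg (c ^ 2 - 1)]
    nlinarith
  have hTm : -1 < T := by
    rw [hT, lt_div_iff₀ (by positivity)]
    have h1 : c * (2 * c ^ 2 + 9) ≤ 2 * R ^ 3 := by
      apply le_of_sq_le_sq_aux (by positivity)
      rw [mul_pow 2, hR6]; nlinarith [sq_nonneg c]
    nlinarith [mul_pos (by linarith : 0 < c) hs2]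
  have hη0 : 0 ≤ η := by rw [hη]; exact Real.arccos_nonneg _
  have hηpi : η < Real.pi := by
    rw [hη]
    refine lt_of_le_of_ne (Real.arccos_le_pi _) ?_
    intro h
    rw [Real.arccos_eq_pi] at h
    linarith
  have hcosη : Real.cos η = T := by rw [hη]; exact Real.cos_arccos hTm.le hT1
  have hpi := Real.pi_pos
  have hx' : x = Real.cos (Real.pi / 3 - η / 3) := by
    rw [hx, ← Real.cos_sub_pi, ← Real.cos_neg]; congr 1; ring
  have hxh : 1 / 2 ≤ x := by
    rw [hx', ← Real.cos_pi_div_three]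
    apply Real.cos_le_cos_of_nonneg_of_le_pi <;> linarith
  have hx3 : 4 * x ^ 3 - 3 * x = - T := by
    rw [hx', ← Real.cos_three_mul, ← hcosη, ← Real.cos_pi_sub]; congr 1; ring
  have hRx : R ≤ 2 * R * x := by nlinarith
  refine ⟨⟨hTm, hT1⟩, ⟨hη0, hηpi⟩, by rw [hv]; linarith, ?_, ?_⟩
  · intro h
    rw [hv] at h
    have hc1 : c = 1 := by linarith
    have hRe : R = 2 := by linarith
    have hxe : x = 1 / 2 := by rw [hc1, hRe] at h; linarith
    refine ⟨hc1, ?_⟩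
    rw [hxe, hT, hc1, hRe] at hx3
    nlinarith
  · rintro ⟨hc1, hse⟩
    have hRe : R = 2 := by subst hc1; nlinarith
    have hTe : T = 1 := by rw [hT, hc1, hse, hRe]; norm_num
    have he : η = 0 := by rw [hη, hTe, Real.arccos_one]
    have hxe : x = 1 / 2 := by rw [hx', he]; simp
    rw [hv, hc1, hRe, hxe]; norm_num


/-- the turning radius `r̄₀` of geodesics of the Eguchi–Hanson metric with
constant `θ ∈ (0, π)` and nonconstant `φ` satisfies `r̄₀ ≥ B^{1/4}`, with equality iff
`|φ₀| = 2|r₁|/B^{1/4}` and `θ = π/2`. -/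
theorem stmt_12 (B : ℝ) (hB : 0 < B) (r₁ : ℝ) (hr₁ : r₁ ≠ 0)
    (θ : ℝ) (hθ : θ ∈ Set.Ioo 0 Real.pi)
    (φ₀ : ℝ) (hφ₀ : |φ₀| ≥ 2 * |r₁| / B ^ ((1 : ℝ) / 4))
    (T : ℝ) (hT : T = Real.sqrt B * φ₀ ^ 2
      * (216 * r₁ ^ 4 * Real.sin θ ^ 2 - B * φ₀ ^ 4 - 72 * r₁ ^ 4)
      / Real.sqrt ((B * φ₀ ^ 4 + 48 * r₁ ^ 4) ^ 3))
    (η : ℝ) (hη : η = Real.arccos T)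
    (rb : ℝ) (hrb : rb = (1 / (2 * Real.sqrt 3)) * Real.sqrt
      (B * φ₀ ^ 2 / r₁ ^ 2
        - 2 * Real.sqrt (B ^ 2 * φ₀ ^ 4 / r₁ ^ 4 + 48 * B)
          * Real.cos (η / 3 + 2 * Real.pi / 3))) :
    (-1 < T ∧ T ≤ 1) ∧ (0 ≤ η ∧ η < Real.pi)
    ∧ B ^ ((1 : ℝ) / 4) ≤ rb
    ∧ (rb = B ^ ((1 : ℝ) / 4) ↔
        |φ₀| = 2 * |r₁| / B ^ ((1 : ℝ) / 4) ∧ θ = Real.pi / 2) := by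
  obtain ⟨q, hq⟩ : ∃ q, q = B ^ ((1 : ℝ) / 4) := ⟨_, rfl⟩
  have hq0 : 0 < q := by rw [hq]; positivity
  have hBq : B = q ^ 4 := by
    rw [hq, ← Real.rpow_natCast, ← Real.rpow_mul hB.le]; norm_num
  rw [← hq] at hφ₀ ⊢
  clear hq
  subst hBq
  obtain ⟨c, hcdef⟩ : ∃ c, c = q ^ 2 * φ₀ ^ 2 / (4 * r₁ ^ 2) := ⟨_, rfl⟩
  have hr2 : 0 < r₁ ^ 2 := by positivity
  have hra : 0 < |r₁| := abs_pos.mpr hr₁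
  have hcs : c = (q * |φ₀| / (2 * |r₁|)) ^ 2 := by
    rw [hcdef, div_pow, mul_pow, mul_pow, sq_abs, sq_abs]; norm_num
  have hd0 : 0 ≤ q * |φ₀| / (2 * |r₁|) := by positivity
  have hd1 : 1 ≤ q * |φ₀| / (2 * |r₁|) := by
    rw [ge_iff_le, div_le_iff₀ hq0] at hφ₀
    rw [le_div_iff₀ (by positivity)]; linarith
  have hc : 1 ≤ c := by rw [hcs]; nlinarith
  have hc1 : c = 1 ↔ |φ₀| = 2 * |r₁| / q := by
    rw [hcs, pow_eq_one_iff_of_nonneg hd0 (by norm_num), div_eq_one_iff_eq (by positivity),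
      eq_div_iff hq0.ne', mul_comm q]
  have hs : 0 < Real.sin θ := Real.sin_pos_of_mem_Ioo hθ
  have hs1 : Real.sin θ = 1 ↔ θ = Real.pi / 2 := by
    constructor
    · intro h
      have hcos : Real.cos θ = 0 := by nlinarith [Real.sin_sq_add_cos_sq θ]
      apply Real.injOn_cos ⟨hθ.1.le, hθ.2.le⟩ ⟨by linarith [Real.pi_pos], by linarith [Real.pi_pos]⟩
      rw [hcos, Real.cos_pi_div_two]
    · rintro h
      rw [h, Real.sin_pi_div_two]
  obtain ⟨R, hR⟩ : ∃ R, R = Real.sqrt (c ^ 2 + 3) := ⟨_, rfl⟩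
  have hR2 : R ^ 2 = c ^ 2 + 3 := by rw [hR]; exact Real.sq_sqrt (by positivity)
  have hR0 : 0 < R := by rw [hR]; exact Real.sqrt_pos.mpr (by positivity)
  have hp : q ^ 2 * φ₀ ^ 2 = 4 * c * r₁ ^ 2 := by rw [hcdef]; field_simp
  have e1 : Real.sqrt (q ^ 4) = q ^ 2 := by
    rw [show q ^ 4 = (q ^ 2) ^ 2 by ring]; exact Real.sqrt_sq (by positivity)
  have e0 : q ^ 4 * φ₀ ^ 4 = 16 * c ^ 2 * r₁ ^ 4 := by
    rw [show q ^ 4 * φ₀ ^ 4 = (q ^ 2 * φ₀ ^ 2) ^ 2 by ring, hp]; ring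
  have e2 : Real.sqrt ((q ^ 4 * φ₀ ^ 4 + 48 * r₁ ^ 4) ^ 3) = 64 * r₁ ^ 6 * R ^ 3 := by
    rw [e0, show (16 * c ^ 2 * r₁ ^ 4 + 48 * r₁ ^ 4) ^ 3 = (64 * r₁ ^ 6 * R ^ 3) ^ 2 by
      rw [show (64 * r₁ ^ 6 * R ^ 3) ^ 2 = 4096 * r₁ ^ 12 * (R ^ 2) ^ 3 by ring, hR2]; ring]
    exact Real.sqrt_sq (by positivity)
  have e3 : Real.sqrt ((q ^ 4) ^ 2 * φ₀ ^ 4 / r₁ ^ 4 + 48 * q ^ 4) = 4 * q ^ 2 * R := by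
    rw [show (q ^ 4) ^ 2 * φ₀ ^ 4 / r₁ ^ 4 + 48 * q ^ 4 = (4 * q ^ 2 * R) ^ 2 by
      rw [show (q ^ 4) ^ 2 * φ₀ ^ 4 = q ^ 4 * (q ^ 4 * φ₀ ^ 4) by ring, e0, mul_pow, hR2]
      field_simp
      ring]
    exact Real.sqrt_sq (by positivity)
  have e4 : q ^ 4 * φ₀ ^ 2 / r₁ ^ 2 = 4 * q ^ 2 * c := by
    rw [show q ^ 4 * φ₀ ^ 2 = q ^ 2 * (q ^ 2 * φ₀ ^ 2) by ring, hp]; field_simp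
  have hT' : T = c * (27 * Real.sin θ ^ 2 - 2 * c ^ 2 - 9) / (2 * R ^ 3) := by
    rw [hT, e2, e1, hp, e0]; field_simp; ring
  obtain ⟨h1, h2, h3, h4⟩ := core_aux c (Real.sin θ) T η _ R _ hc hs (Real.sin_le_one θ) hR hT' hη rfl rfl
  obtain ⟨v, hv⟩ : ∃ v, v = (c + 2 * R * -Real.cos (η / 3 + 2 * Real.pi / 3)) / 3 := ⟨_, rfl⟩
  rw [← hv] at h3 h4
  have hrb' : rb = q * Real.sqrt v := by
    rw [hrb, e3, e4, show 4 * q ^ 2 * c - 2 * (4 * q ^ 2 * R) * Real.cos (η / 3 + 2 * Real.pi / 3)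
      = (2 * q) ^ 2 * (3 * v) by rw [hv]; ring, Real.sqrt_mul (by positivity),
      Real.sqrt_sq (by positivity), Real.sqrt_mul (by norm_num)]
    field_simp
  refine ⟨h1, h2, ?_, ?_⟩
  · rw [hrb']
    have := Real.one_le_sqrt.mpr h3
    nlinarith
  · rw [hrb', mul_eq_left₀ hq0.ne', Real.sqrt_eq_one, h4, hc1, hs1]
end

section
/- Let B > 0, r₁ ≠ 0, θ ∈ (0, π), and let φ₀ be a real constant with √B·φ₀²/(4r₁²) ≥ 1. Define T = √B·φ₀²·(216·r₁⁴·sin²θ − B·φ₀⁴ − 72·r₁⁴)/√((B·φ₀⁴ + 48·r₁⁴)³) (which lies in (−1, 1]), η = arccos T, S = √(B²·φ₀⁴ + 48B·r₁⁴), and u₂ = (1/(12r₁²))·(B·φ₀² − 2S·cos(η/3 + 2π/3)), u₃ = (1/(12r₁²))·(B·φ₀² − 2S·cos(η/3 − 2π/3)), u₄ = (1/(12r₁²))·(B·φ₀² − 2S·cos(η/3)). Then for all real u: u³ − (B·φ₀²/(4r₁²))·u² − B·u + (B²·φ₀²/(4r₁²))·sin²θ = (u − u₂)·(u − u₃)·(u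 − u₄); that is, u₂, u₃, u₄ are the three real roots of this cubic. -/
/-- trigonometric (Cardano–Viète) factorization of the cubic
`u³ − (Bφ₀²/(4r₁²))u² − Bu + (B²φ₀²/(4r₁²))sin²θ` arising in the integration of the
geodesic equations of the Eguchi–Hanson metric with constant `θ` and nonconstant `φ`. -/
theorem stmt_13 (B : ℝ) (hB : 0 < B) (r₁ : ℝ) (hr₁ : r₁ ≠ 0)
    (θ : ℝ) (hθ : θ ∈ Set.Ioo 0 Real.pi)
    (φ₀ : ℝ) (hφ₀ : Real.sqrt B * φ₀ ^ 2 / (4 * r₁ ^ 2) ≥ 1)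
    (T : ℝ) (hT : T = Real.sqrt B * φ₀ ^ 2
      * (216 * r₁ ^ 4 * Real.sin θ ^ 2 - B * φ₀ ^ 4 - 72 * r₁ ^ 4)
      / Real.sqrt ((B * φ₀ ^ 4 + 48 * r₁ ^ 4) ^ 3))
    (η : ℝ) (hη : η = Real.arccos T)
    (S : ℝ) (hS : S = Real.sqrt (B ^ 2 * φ₀ ^ 4 + 48 * B * r₁ ^ 4))
    (u₂ u₃ u₄ : ℝ)
    (hu₂ : u₂ = (1 / (12 * r₁ ^ 2))
      * (B * φ₀ ^ 2 - 2 * S * Real.cos (η / 3 + 2 * Real.pi / 3)))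
    (hu₃ : u₃ = (1 / (12 * r₁ ^ 2))
      * (B * φ₀ ^ 2 - 2 * S * Real.cos (η / 3 - 2 * Real.pi / 3)))
    (hu₄ : u₄ = (1 / (12 * r₁ ^ 2))
      * (B * φ₀ ^ 2 - 2 * S * Real.cos (η / 3))) :
    (-1 < T ∧ T ≤ 1)
    ∧ (∀ u : ℝ, u ^ 3 - (B * φ₀ ^ 2 / (4 * r₁ ^ 2)) * u ^ 2 - B * u
        + (B ^ 2 * φ₀ ^ 2 / (4 * r₁ ^ 2)) * Real.sin θ ^ 2
      = (u - u₂) * (u - u₃) * (u - u₄)) := by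
  obtain ⟨b, hb⟩ : ∃ b, b = Real.sqrt B := ⟨_, rfl⟩
  have hb0 : 0 < b := hb ▸ Real.sqrt_pos.2 hB
  have hBb : B = b ^ 2 := by rw [hb, Real.sq_sqrt hB.le]
  have hq : 0 < r₁ ^ 2 := by positivity
  rw [← hb] at hφ₀ hT
  obtain ⟨a, ha⟩ : ∃ a, a = b * φ₀ ^ 2 / (4 * r₁ ^ 2) := ⟨_, rfl⟩
  rw [← ha] at hφ₀
  have hp : b * φ₀ ^ 2 = 4 * a * r₁ ^ 2 := by rw [ha]; field_simp
  obtain ⟨m, hm⟩ : ∃ m, m = Real.sqrt (a ^ 2 + 3) := ⟨_, rfl⟩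
  have hm0 : 0 < m := hm ▸ Real.sqrt_pos.2 (by positivity)
  have hm2 : m ^ 2 = a ^ 2 + 3 := by rw [hm, Real.sq_sqrt (by positivity)]
  obtain ⟨s, hs⟩ : ∃ s, s = Real.sin θ ^ 2 := ⟨_, rfl⟩
  have hs0 : 0 < s := by
    rw [hs]; exact pow_pos (Real.sin_pos_of_pos_of_lt_pi hθ.1 hθ.2) 2
  have hs1 : s ≤ 1 := by rw [hs]; exact Real.sin_sq_le_one θ
  rw [← hs] at hT ⊢
  have hBp : B * φ₀ ^ 4 = 16 * a ^ 2 * r₁ ^ 4 := by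
    rw [hBb]; linear_combination (b * φ₀ ^ 2 + 4 * a * r₁ ^ 2) * hp
  have e1 : Real.sqrt ((B * φ₀ ^ 4 + 48 * r₁ ^ 4) ^ 3) = (4 * r₁ ^ 2 * m) ^ 3 := by
    have : (B * φ₀ ^ 4 + 48 * r₁ ^ 4) ^ 3 = ((4 * r₁ ^ 2 * m) ^ 3) ^ 2 := by
      have : B * φ₀ ^ 4 + 48 * r₁ ^ 4 = (4 * r₁ ^ 2 * m) ^ 2 := by
        linear_combination hBp - 16 * r₁ ^ 4 * hm2
      rw [this]; ring
    rw [this, Real.sqrt_sq (by positivity)]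
  have e2 : S = 4 * b * r₁ ^ 2 * m := by
    have : B ^ 2 * φ₀ ^ 4 + 48 * B * r₁ ^ 4 = (4 * b * r₁ ^ 2 * m) ^ 2 := by
      linear_combination B * hBp - 16 * b ^ 2 * r₁ ^ 4 * hm2 + (16 * a ^ 2 * r₁ ^ 4 + 48 * r₁ ^ 4) * hBb
    rw [hS, this, Real.sqrt_sq (by positivity)]
  have hT2 : 2 * m ^ 3 * T = a * (27 * s - 2 * a ^ 2 - 9) := by
    rw [hT, e1, hp, hBp]; field_simp; ring
  have hm6 : (m ^ 3) ^ 2 = (a ^ 2 + 3) ^ 3 := by rw [← hm2]; ring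
  have hm3 : 0 < m ^ 3 := by positivity
  have ha0 : 0 < a := by linarith
  have hTl : -1 < T := by
    have h1 : a * (2 * a ^ 2 + 9) < 2 * m ^ 3 := by
      apply lt_of_pow_lt_pow_left₀ 2 (by positivity)
      rw [mul_pow 2, hm6]; nlinarith [sq_nonneg a]
    have h2 : 0 < a * s := by positivity
    refine lt_of_mul_lt_mul_left (a := 2 * m ^ 3) ?_ (by positivity)
    rw [hT2]
    linarith [h1, h2]
  have hTu : T ≤ 1 := by
    have h1 : a * (18 - 2 * a ^ 2) ≤ 2 * m ^ 3 := by
      refine (abs_le_of_sq_le_sq' ?_ (by positivity)).2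
      rw [mul_pow 2, hm6]; nlinarith [sq_nonneg (a ^ 2 - 1)]
    have h2 : a * s ≤ a * 1 := by gcongr
    refine le_of_mul_le_mul_left (a := 2 * m ^ 3) ?_ (by positivity)
    rw [hT2]
    linarith [h1, h2]
  refine ⟨⟨hTl, hTu⟩, fun u => ?_⟩
  have hc : 4 * Real.cos (η / 3) ^ 3 - 3 * Real.cos (η / 3) = T := by
    rw [← Real.cos_three_mul, show 3 * (η / 3) = η by ring, hη, Real.cos_arccos hTl.le hTu]
  have h23 : 2 * Real.pi / 3 = Real.pi - Real.pi / 3 := by ring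
  have hsum : Real.cos (η / 3 + 2 * Real.pi / 3) + Real.cos (η / 3 - 2 * Real.pi / 3)
      = - Real.cos (η / 3) := by
    rw [Real.cos_add, Real.cos_sub, h23, Real.cos_pi_sub, Real.sin_pi_sub, Real.cos_pi_div_three]
    ring
  have hprod : Real.cos (η / 3 + 2 * Real.pi / 3) * Real.cos (η / 3 - 2 * Real.pi / 3)
      = Real.cos (η / 3) ^ 2 - 3 / 4 := by
    rw [Real.cos_add, Real.cos_sub, h23, Real.cos_pi_sub, Real.sin_pi_sub, Real.cos_pi_div_three,
      Real.sin_pi_div_three]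
    have h3 : Real.sqrt 3 ^ 2 = 3 := Real.sq_sqrt (by norm_num)
    have h4 := Real.sin_sq_add_cos_sq (η / 3)
    linear_combination (-Real.sin (η / 3) ^ 2 / 4) * h3 - 3 / 4 * h4
  generalize Real.cos (η / 3 + 2 * Real.pi / 3) = c2 at *
  generalize Real.cos (η / 3 - 2 * Real.pi / 3) = c3 at *
  generalize Real.cos (η / 3) = c at *
  have key : ∀ x : ℝ, (1 / (12 * r₁ ^ 2)) * (B * φ₀ ^ 2 - 2 * S * x)
      = b * a / 3 - 2 * b * m / 3 * x := by
    intro x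
    have : B * φ₀ ^ 2 = b * (4 * a * r₁ ^ 2) := by rw [hBb, ← hp]; ring
    rw [this, e2]; field_simp; ring
  rw [key] at hu₂ hu₃ hu₄
  have k1 : B * φ₀ ^ 2 / (4 * r₁ ^ 2) = b * a := by rw [ha, hBb]; ring
  have k2 : B ^ 2 * φ₀ ^ 2 / (4 * r₁ ^ 2) = b ^ 3 * a := by rw [ha, hBb]; ring
  rw [k1, k2, hu₂, hu₃, hu₄, hBb]
  obtain ⟨y, hy⟩ : ∃ y, y = u - b * a / 3 := ⟨_, rfl⟩
  obtain ⟨k, hk⟩ : ∃ k, k = 2 * b * m / 3 := ⟨_, rfl⟩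
  have f1 : (u - (b * a / 3 - 2 * b * m / 3 * c2)) * (u - (b * a / 3 - 2 * b * m / 3 * c3))
      * (u - (b * a / 3 - 2 * b * m / 3 * c)) = y ^ 3 - 3 / 4 * k ^ 2 * y + k ^ 3 / 4 * T := by
    rw [← hk, show u = y + b * a / 3 by rw [hy]; ring]
    linear_combination (k * y ^ 2 + k ^ 2 * y * c) * hsum + (k ^ 2 * y + k ^ 3 * c) * hprod
      + k ^ 3 / 4 * hc
  have f2 : k ^ 3 / 4 * T = b ^ 3 / 27 * (a * (27 * s - 2 * a ^ 2 - 9)) := by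
    rw [← hT2, hk]; ring
  have f3 : k ^ 2 = 4 / 9 * b ^ 2 * (a ^ 2 + 3) := by rw [← hm2, hk]; ring
  rw [f1, f2, f3, hy]; ring
end

section
/- Let B > 0, ε ∈ {−1, 1}, t₁, φ₁ ∈ ℝ, and let φ₀, r₁ be real constants with r₁ > B^{1/4}·|φ₀|/2 and r₁ > 0. Set f(r) = 1 − B/r⁴. For r > B^{1/4} define α(r) = arcsin √((4r₁²r² − 4√B·r₁²)/(4r₁²r² − B·φ₀²)), k² = 1/2 + √B·φ₀²/(8r₁²), t(r) = t₁ + (ε/r₁)·[ 2r₁·√(r⁴ − B)/√(4r₁²r² − B·φ₀²) − √2·B^{1/4}·E(α(r), k²) + (B^{1/4}/√2)·F(α(r), k²) ], and φ(r) = φ₁ + (ε·B^{1/4}·φ₀/(√2·r₁))·F(α(r), k²). Then t and φ are differentiable on (B^{1/4}, ∞) with t'(r) = ε/(r₁·√((1 − B·φ₀²/(4r₁²r²))·f(r))) and φ'(r) = ε·√B·φ₀/(r₁·r²·√((1 − B·φ₀²/(4r₁²r²))·f(r))), and t(r) → t₁, φ(r) → φ₁ as r → B^{1/4}⁺. (This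 is the geodesic of the Eguchi–Hanson metric with θ ≡ π/2, ψ constant and nonconstant φ, passing through the removable singularity B^{1/4}.) -/
lemma eh_pos (k : ℝ) (hk0 : 0 ≤ k) (hk : k < 1) (x : ℝ) : 0 < 1 - k * Real.sin x ^ 2 := by
  have := Real.sin_sq_le_one x
  have := mul_le_mul_of_nonneg_left this hk0
  linarith

lemma eh_contF (k : ℝ) (hk0 : 0 ≤ k) (hk : k < 1) :
    Continuous (fun x : ℝ => 1 / Real.sqrt (1 - k * Real.sin x ^ 2)) := by
  refine Continuous.div continuous_const (by fun_prop) ?_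
  intro x
  exact (Real.sqrt_pos.2 (eh_pos k hk0 hk x)).ne'

lemma eh_contE (k : ℝ) :
    Continuous (fun x : ℝ => Real.sqrt (1 - k * Real.sin x ^ 2)) := by
  fun_prop

lemma eh_derivF (k : ℝ) (hk0 : 0 ≤ k) (hk : k < 1) (a : ℝ) :
    HasDerivAt (fun a => ellF a k) (1 / Real.sqrt (1 - k * Real.sin a ^ 2)) a := by
  have h := eh_contF k hk0 hk
  exact intervalIntegral.integral_hasDerivAt_right (h.intervalIntegrable _ _)
    (h.stronglyMeasurableAtFilter _ _) h.continuousAt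

lemma eh_derivE (k : ℝ) (a : ℝ) :
    HasDerivAt (fun a => ellE a k) (Real.sqrt (1 - k * Real.sin a ^ 2)) a := by
  have h := eh_contE k
  exact intervalIntegral.integral_hasDerivAt_right (h.intervalIntegrable _ _)
    (h.stronglyMeasurableAtFilter _ _) h.continuousAt

lemma eh_F0 (k : ℝ) : ellF 0 k = 0 := by simp [ellF]
lemma eh_E0 (k : ℝ) : ellE 0 k = 0 := by simp [ellE]

lemma eh_D (b m r : ℝ) (hb : 0 < b) (hm : m < 1) (hr : b ≤ r) : 0 < r ^ 2 - b ^ 2 * m := by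
  have : 0 < b ^ 2 * (1 - m) := mul_pos (by positivity) (by linarith)
  nlinarith

lemma eh_alpha (b m r : ℝ) (hb : 0 < b) (hm : m < 1) (hr : b < r) :
    HasDerivAt (fun r : ℝ => Real.arcsin (Real.sqrt ((r ^ 2 - b ^ 2) / (r ^ 2 - b ^ 2 * m))))
      (r * b * Real.sqrt (1 - m) / ((r ^ 2 - b ^ 2 * m) * Real.sqrt (r ^ 2 - b ^ 2))) r := by
  have hD := eh_D b m r hb hm hr.le
  have hN : 0 < r ^ 2 - b ^ 2 := by nlinarith
  have h1m : 0 < 1 - m := by linarith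
  have hb2 : 0 < b ^ 2 * (1 - m) := by positivity
  set u := (r ^ 2 - b ^ 2) / (r ^ 2 - b ^ 2 * m) with hu
  have hu0 : 0 < u := div_pos hN hD
  have hu1' : 1 - u = b ^ 2 * (1 - m) / (r ^ 2 - b ^ 2 * m) := by
    rw [hu]; field_simp; ring
  have hu1 : 0 < 1 - u := by rw [hu1']; positivity
  have hs0 : 0 < Real.sqrt u := Real.sqrt_pos.2 hu0
  have hs1 : Real.sqrt u < 1 := by
    rw [Real.sqrt_lt' one_pos]; linarith
  have e1 : HasDerivAt (fun r : ℝ => r ^ 2 - b ^ 2) (2 * r) r := by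
    simpa using (hasDerivAt_pow 2 r).sub_const (b ^ 2)
  have e2 : HasDerivAt (fun r : ℝ => r ^ 2 - b ^ 2 * m) (2 * r) r := by
    simpa using (hasDerivAt_pow 2 r).sub_const (b ^ 2 * m)
  have e3 := (e1.fun_div e2 hD.ne').sqrt hu0.ne'
  have e4 := (Real.hasDerivAt_arcsin (x := Real.sqrt u) (by linarith) hs1.ne).comp r e3
  refine e4.congr_deriv ?_
  rw [← hu, Real.sq_sqrt hu0.le, hu1', hu, Real.sqrt_div hN.le, Real.sqrt_div hb2.le,
    Real.sqrt_mul (by positivity), Real.sqrt_sq hb.le]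
  have hP : 0 < Real.sqrt (r ^ 2 - b ^ 2 * m) := Real.sqrt_pos.2 hD
  have hPs := Real.sq_sqrt hD.le
  have hM : 0 < Real.sqrt (1 - m) := Real.sqrt_pos.2 h1m
  have hMs := Real.sq_sqrt h1m.le
  have hS : 0 < Real.sqrt (r ^ 2 - b ^ 2) := Real.sqrt_pos.2 hN
  generalize Real.sqrt (r ^ 2 - b ^ 2 * m) = P at *
  generalize Real.sqrt (1 - m) = M at *
  generalize Real.sqrt (r ^ 2 - b ^ 2) = S at *
  have hX : 2 * r * (r ^ 2 - b ^ 2 * m) - (r ^ 2 - b ^ 2) * (2 * r) = 2 * r * b ^ 2 * M ^ 2 := by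
    rw [hMs]; ring
  rw [hX, ← hPs]
  field_simp

lemma eh_alpha_delta (b m r : ℝ) (hb : 0 < b) (hm : m < 1) (hr : b < r) :
    1 - (1 + m) / 2 * Real.sin
      (Real.arcsin (Real.sqrt ((r ^ 2 - b ^ 2) / (r ^ 2 - b ^ 2 * m)))) ^ 2
      = (1 - m) * (r ^ 2 + b ^ 2) / (2 * (r ^ 2 - b ^ 2 * m)) := by
  have hD := eh_D b m r hb hm hr.le
  have hN : 0 < r ^ 2 - b ^ 2 := by nlinarith
  have h1m : 0 < 1 - m := by linarith
  have hu0 := (div_pos hN hD)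
  have hu1 : (r ^ 2 - b ^ 2) / (r ^ 2 - b ^ 2 * m) ≤ 1 := by
    rw [div_le_one hD]; nlinarith [mul_pos (pow_pos hb 2) h1m]
  rw [Real.sin_arcsin (by linarith [Real.sqrt_nonneg ((r ^ 2 - b ^ 2) / (r ^ 2 - b ^ 2 * m))])
    (Real.sqrt_le_one.2 hu1), Real.sq_sqrt hu0.le]
  clear hu0 hu1
  obtain ⟨D, hDe⟩ : ∃ D, D = r ^ 2 - b ^ 2 * m := ⟨_, rfl⟩
  rw [← hDe] at hD ⊢
  field_simp
  rw [hDe]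
  ring

lemma eh_F' (b m r : ℝ) (hb : 0 < b) (hm0 : 0 ≤ m) (hm : m < 1) (hr : b < r) :
    HasDerivAt (fun r : ℝ => ellF (Real.arcsin (Real.sqrt ((r ^ 2 - b ^ 2) / (r ^ 2 - b ^ 2 * m))))
      ((1 + m) / 2))
      (Real.sqrt 2 * r * b / (Real.sqrt (r ^ 2 - b ^ 2 * m) * Real.sqrt (r ^ 4 - b ^ 4))) r := by
  have h := (eh_derivF ((1 + m) / 2) (by linarith) (by linarith) _).comp r (eh_alpha b m r hb hm hr)
  refine h.congr_deriv ?_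
  rw [eh_alpha_delta b m r hb hm hr]
  have hD := eh_D b m r hb hm hr.le
  have hN : 0 < r ^ 2 - b ^ 2 := by nlinarith
  have h1m : 0 < 1 - m := by linarith
  have hT : 0 < r ^ 2 + b ^ 2 := by positivity
  have hQ : r ^ 4 - b ^ 4 = (r ^ 2 - b ^ 2) * (r ^ 2 + b ^ 2) := by ring
  rw [hQ, Real.sqrt_mul hN.le, Real.sqrt_div (by positivity), Real.sqrt_mul h1m.le,
    Real.sqrt_mul zero_le_two]
  have hP : 0 < Real.sqrt (r ^ 2 - b ^ 2 * m) := Real.sqrt_pos.2 hD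
  have hPs := Real.sq_sqrt hD.le
  have hM : 0 < Real.sqrt (1 - m) := Real.sqrt_pos.2 h1m
  have hS : 0 < Real.sqrt (r ^ 2 - b ^ 2) := Real.sqrt_pos.2 hN
  have hT' : 0 < Real.sqrt (r ^ 2 + b ^ 2) := Real.sqrt_pos.2 hT
  generalize Real.sqrt (r ^ 2 - b ^ 2 * m) = P at *
  rw [← hPs]
  field_simp

lemma eh_E' (b m r : ℝ) (hb : 0 < b) (hm : m < 1) (hr : b < r) :
    HasDerivAt (fun r : ℝ => ellE (Real.arcsin (Real.sqrt ((r ^ 2 - b ^ 2) / (r ^ 2 - b ^ 2 * m))))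
      ((1 + m) / 2))
      (r * b * (1 - m) * (r ^ 2 + b ^ 2) / (Real.sqrt 2 * (r ^ 2 - b ^ 2 * m) *
        Real.sqrt (r ^ 2 - b ^ 2 * m) * Real.sqrt (r ^ 4 - b ^ 4))) r := by
  have h := (eh_derivE ((1 + m) / 2) _).comp r (eh_alpha b m r hb hm hr)
  refine h.congr_deriv ?_
  rw [eh_alpha_delta b m r hb hm hr]
  have hD := eh_D b m r hb hm hr.le
  have hN : 0 < r ^ 2 - b ^ 2 := by nlinarith
  have h1m : 0 < 1 - m := by linarith
  have hT : 0 < r ^ 2 + b ^ 2 := by positivity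
  have hQ : r ^ 4 - b ^ 4 = (r ^ 2 - b ^ 2) * (r ^ 2 + b ^ 2) := by ring
  rw [hQ, Real.sqrt_mul hN.le, Real.sqrt_div (by positivity), Real.sqrt_mul h1m.le,
    Real.sqrt_mul zero_le_two]
  have hP : 0 < Real.sqrt (r ^ 2 - b ^ 2 * m) := Real.sqrt_pos.2 hD
  have hM : 0 < Real.sqrt (1 - m) := Real.sqrt_pos.2 h1m
  have hS : 0 < Real.sqrt (r ^ 2 - b ^ 2) := Real.sqrt_pos.2 hN
  have hT' : 0 < Real.sqrt (r ^ 2 + b ^ 2) := Real.sqrt_pos.2 hT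
  have hMs := Real.sq_sqrt h1m.le
  have hTs := Real.sq_sqrt hT.le
  generalize Real.sqrt (1 - m) = M at *
  generalize Real.sqrt (r ^ 2 + b ^ 2) = T at *
  rw [← hMs, ← hTs]
  field_simp

lemma eh_G' (b m r : ℝ) (hb : 0 < b) (hm : m < 1) (hr : b < r) :
    HasDerivAt (fun r : ℝ => Real.sqrt (r ^ 4 - b ^ 4) / Real.sqrt (r ^ 2 - b ^ 2 * m))
      ((2 * r ^ 3 * (r ^ 2 - b ^ 2 * m) - r * (r ^ 4 - b ^ 4)) / ((r ^ 2 - b ^ 2 * m) *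
        Real.sqrt (r ^ 2 - b ^ 2 * m) * Real.sqrt (r ^ 4 - b ^ 4))) r := by
  have hD := eh_D b m r hb hm hr.le
  have hQ : 0 < r ^ 4 - b ^ 4 := by
    have := pow_lt_pow_left₀ hr hb.le (n := 4) (by norm_num)
    linarith
  have e1 : HasDerivAt (fun r : ℝ => r ^ 4 - b ^ 4) (4 * r ^ 3) r := by
    simpa using (hasDerivAt_pow 4 r).sub_const (b ^ 4)
  have e2 : HasDerivAt (fun r : ℝ => r ^ 2 - b ^ 2 * m) (2 * r) r := by
    simpa using (hasDerivAt_pow 2 r).sub_const (b ^ 2 * m)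
  have hP : 0 < Real.sqrt (r ^ 2 - b ^ 2 * m) := Real.sqrt_pos.2 hD
  have hS : 0 < Real.sqrt (r ^ 4 - b ^ 4) := Real.sqrt_pos.2 hQ
  refine ((e1.sqrt hQ.ne').fun_div (e2.sqrt hD.ne') hP.ne').congr_deriv ?_
  have hPs := Real.sq_sqrt hD.le
  have hSs := Real.sq_sqrt hQ.le
  generalize Real.sqrt (r ^ 2 - b ^ 2 * m) = P at *
  generalize Real.sqrt (r ^ 4 - b ^ 4) = S at *
  rw [← hPs, ← hSs]
  field_simp
  ring

lemma eh_tot (b m r : ℝ) (hb : 0 < b) (hm0 : 0 ≤ m) (hm : m < 1) (hr : b < r) :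
    HasDerivAt (fun r : ℝ => Real.sqrt (r ^ 4 - b ^ 4) / Real.sqrt (r ^ 2 - b ^ 2 * m)
      - Real.sqrt 2 * b * ellE (Real.arcsin (Real.sqrt ((r ^ 2 - b ^ 2) / (r ^ 2 - b ^ 2 * m))))
        ((1 + m) / 2)
      + b / Real.sqrt 2 * ellF (Real.arcsin (Real.sqrt ((r ^ 2 - b ^ 2) / (r ^ 2 - b ^ 2 * m))))
        ((1 + m) / 2))
      (r ^ 3 / (Real.sqrt (r ^ 2 - b ^ 2 * m) * Real.sqrt (r ^ 4 - b ^ 4))) r := by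
  refine (((eh_G' b m r hb hm hr).fun_sub ((eh_E' b m r hb hm hr).const_mul _)).fun_add
    ((eh_F' b m r hb hm0 hm hr).const_mul _)).congr_deriv ?_
  have hD := eh_D b m r hb hm hr.le
  have hQ : 0 < r ^ 4 - b ^ 4 := by
    have := pow_lt_pow_left₀ hr hb.le (n := 4) (by norm_num)
    linarith
  have hP : 0 < Real.sqrt (r ^ 2 - b ^ 2 * m) := Real.sqrt_pos.2 hD
  have hS : 0 < Real.sqrt (r ^ 4 - b ^ 4) := Real.sqrt_pos.2 hQ
  generalize Real.sqrt (r ^ 2 - b ^ 2 * m) = P at *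
  generalize Real.sqrt (r ^ 4 - b ^ 4) = S at *
  field_simp
  ring

lemma eh_rhs (b m r : ℝ) (hb : 0 < b) (hm : m < 1) (hr : b < r) :
    Real.sqrt ((1 - b ^ 2 * m / r ^ 2) * (1 - b ^ 4 / r ^ 4)) =
      Real.sqrt (r ^ 2 - b ^ 2 * m) * Real.sqrt (r ^ 4 - b ^ 4) / r ^ 3 := by
  have hD := eh_D b m r hb hm hr.le
  have hr0 : 0 < r := hb.trans hr
  have : (1 - b ^ 2 * m / r ^ 2) * (1 - b ^ 4 / r ^ 4) =
      (r ^ 2 - b ^ 2 * m) * (r ^ 4 - b ^ 4) / (r ^ 3) ^ 2 := by field_simp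
  rw [this, Real.sqrt_div', Real.sqrt_sq (by positivity), Real.sqrt_mul hD.le]
  positivity

/-- geodesics of the Eguchi–Hanson metric with `θ ≡ π/2`, `ψ` constant and
nonconstant `φ`, passing through the removable singularity `B^{1/4}`. -/
theorem stmt_15 (B : ℝ) (hB : 0 < B)
    (ε : ℝ) (hε : ε = 1 ∨ ε = -1) (t₁ φ₁ : ℝ)
    (φ₀ r₁ : ℝ) (hr₁pos : 0 < r₁) (hr₁ : r₁ > B ^ ((1 : ℝ) / 4) * |φ₀| / 2)
    (f : ℝ → ℝ) (hf : ∀ r, f r = 1 - B / r ^ 4)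
    (α : ℝ → ℝ) (hα : ∀ r, α r = Real.arcsin (Real.sqrt
      ((4 * r₁ ^ 2 * r ^ 2 - 4 * Real.sqrt B * r₁ ^ 2)
        / (4 * r₁ ^ 2 * r ^ 2 - B * φ₀ ^ 2))))
    (k2 : ℝ) (hk2 : k2 = 1 / 2 + Real.sqrt B * φ₀ ^ 2 / (8 * r₁ ^ 2))
    (t φ : ℝ → ℝ)
    (ht : ∀ r, t r = t₁ + (ε / r₁) *
      (2 * r₁ * Real.sqrt (r ^ 4 - B) / Real.sqrt (4 * r₁ ^ 2 * r ^ 2 - B * φ₀ ^ 2)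
        - Real.sqrt 2 * B ^ ((1 : ℝ) / 4) * ellE (α r) k2
        + (B ^ ((1 : ℝ) / 4) / Real.sqrt 2) * ellF (α r) k2))
    (hφ : ∀ r, φ r = φ₁
      + (ε * B ^ ((1 : ℝ) / 4) * φ₀ / (Real.sqrt 2 * r₁)) * ellF (α r) k2) :
    (∀ r, B ^ ((1 : ℝ) / 4) < r → HasDerivAt t
      (ε / (r₁ * Real.sqrt ((1 - B * φ₀ ^ 2 / (4 * r₁ ^ 2 * r ^ 2)) * f r))) r)
    ∧ (∀ r, B ^ ((1 : ℝ) / 4) < r → HasDerivAt φ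
      (ε * Real.sqrt B * φ₀ /
        (r₁ * r ^ 2 * Real.sqrt ((1 - B * φ₀ ^ 2 / (4 * r₁ ^ 2 * r ^ 2)) * f r))) r)
    ∧ Filter.Tendsto t (nhdsWithin (B ^ ((1 : ℝ) / 4)) (Set.Ioi (B ^ ((1 : ℝ) / 4)))) (nhds t₁)
    ∧ Filter.Tendsto φ (nhdsWithin (B ^ ((1 : ℝ) / 4)) (Set.Ioi (B ^ ((1 : ℝ) / 4)))) (nhds φ₁) := by
  obtain ⟨b, hbdef⟩ : ∃ b, b = B ^ ((1 : ℝ) / 4) := ⟨_, rfl⟩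
  have hb : 0 < b := by rw [hbdef]; positivity
  have hB4 : B = b ^ 4 := by
    rw [hbdef, ← Real.rpow_natCast, ← Real.rpow_mul hB.le]; norm_num
  simp only [← hbdef] at hr₁ ht hφ ⊢
  have hsB : Real.sqrt B = b ^ 2 := by
    rw [hB4, show b ^ 4 = (b ^ 2) ^ 2 by ring, Real.sqrt_sq (by positivity)]
  clear hbdef
  simp only [hsB] at hα hk2 ⊢
  clear hsB
  subst hB4
  obtain ⟨m, hmdef⟩ : ∃ m, m = b ^ 2 * φ₀ ^ 2 / (4 * r₁ ^ 2) := ⟨_, rfl⟩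
  have hm0 : 0 ≤ m := by rw [hmdef]; positivity
  have hm1 : m < 1 := by
    rw [hmdef, div_lt_one (by positivity)]
    have h2 : b * |φ₀| < 2 * r₁ := by linarith
    have := pow_lt_pow_left₀ h2 (by positivity) (n := 2) (by norm_num)
    rw [mul_pow, sq_abs] at this
    linarith
  have hk : k2 = (1 + m) / 2 := by rw [hk2, hmdef]; field_simp; ring
  have hDD : ∀ r : ℝ, 4 * r₁ ^ 2 * r ^ 2 - b ^ 4 * φ₀ ^ 2 = (2 * r₁) ^ 2 * (r ^ 2 - b ^ 2 * m) := by
    intro r; rw [hmdef]; field_simp; ring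
  have hαe : ∀ r, α r = Real.arcsin (Real.sqrt ((r ^ 2 - b ^ 2) / (r ^ 2 - b ^ 2 * m))) := by
    intro r
    rw [hα, hDD, show 4 * r₁ ^ 2 * r ^ 2 - 4 * b ^ 2 * r₁ ^ 2 = (2 * r₁) ^ 2 * (r ^ 2 - b ^ 2) by ring,
      mul_div_mul_left _ _ (by positivity)]
  have hte : t = fun r => t₁ + (ε / r₁) * (Real.sqrt (r ^ 4 - b ^ 4) / Real.sqrt (r ^ 2 - b ^ 2 * m)
      - Real.sqrt 2 * b * ellE (Real.arcsin (Real.sqrt ((r ^ 2 - b ^ 2) / (r ^ 2 - b ^ 2 * m))))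
        ((1 + m) / 2)
      + b / Real.sqrt 2 * ellF (Real.arcsin (Real.sqrt ((r ^ 2 - b ^ 2) / (r ^ 2 - b ^ 2 * m))))
        ((1 + m) / 2)) := by
    funext r
    rw [ht, hDD, hαe, hk, Real.sqrt_mul (by positivity), Real.sqrt_sq (by positivity),
      mul_div_mul_left _ _ (by positivity)]
  have hφe : φ = fun r => φ₁ + (ε * b * φ₀ / (Real.sqrt 2 * r₁)) *
      ellF (Real.arcsin (Real.sqrt ((r ^ 2 - b ^ 2) / (r ^ 2 - b ^ 2 * m)))) ((1 + m) / 2) := by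
    funext r
    rw [hφ, hαe, hk]
  have hR : ∀ r, b < r → Real.sqrt ((1 - b ^ 4 * φ₀ ^ 2 / (4 * r₁ ^ 2 * r ^ 2)) * f r) =
      Real.sqrt (r ^ 2 - b ^ 2 * m) * Real.sqrt (r ^ 4 - b ^ 4) / r ^ 3 := by
    intro r hr
    have hr0 : 0 < r := hb.trans hr
    rw [← eh_rhs b m r hb hm1 hr, hf, show b ^ 4 * φ₀ ^ 2 / (4 * r₁ ^ 2 * r ^ 2) = b ^ 2 * m / r ^ 2 by
      rw [hmdef]; field_simp]
  have hpos : ∀ r, b < r → 0 < Real.sqrt (r ^ 2 - b ^ 2 * m) ∧ 0 < Real.sqrt (r ^ 4 - b ^ 4) := by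
    intro r hr
    refine ⟨Real.sqrt_pos.2 (eh_D b m r hb hm1 hr.le), Real.sqrt_pos.2 ?_⟩
    have := pow_lt_pow_left₀ hr hb.le (n := 4) (by norm_num)
    linarith
  have hDb := eh_D b m b hb hm1 le_rfl
  have cα : ContinuousAt
      (fun r : ℝ => Real.arcsin (Real.sqrt ((r ^ 2 - b ^ 2) / (r ^ 2 - b ^ 2 * m)))) b := by
    refine Real.continuous_arcsin.continuousAt.comp (Real.continuous_sqrt.continuousAt.comp ?_)
    exact ContinuousAt.div (by fun_prop) (by fun_prop) hDb.ne'
  have cF : ContinuousAt (fun r : ℝ => ellF (Real.arcsin (Real.sqrt ((r ^ 2 - b ^ 2) /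
      (r ^ 2 - b ^ 2 * m)))) ((1 + m) / 2)) b :=
    ContinuousAt.comp (f := fun r : ℝ => Real.arcsin (Real.sqrt ((r ^ 2 - b ^ 2) / (r ^ 2 - b ^ 2 * m))))
      (g := fun a => ellF a ((1 + m) / 2))
      (eh_derivF ((1 + m) / 2) (by linarith) (by linarith) _).continuousAt cα
  have cE : ContinuousAt (fun r : ℝ => ellE (Real.arcsin (Real.sqrt ((r ^ 2 - b ^ 2) /
      (r ^ 2 - b ^ 2 * m)))) ((1 + m) / 2)) b :=
    ContinuousAt.comp (f := fun r : ℝ => Real.arcsin (Real.sqrt ((r ^ 2 - b ^ 2) / (r ^ 2 - b ^ 2 * m))))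
      (g := fun a => ellE a ((1 + m) / 2))
      (eh_derivE ((1 + m) / 2) _).continuousAt cα
  have cG : ContinuousAt
      (fun r : ℝ => Real.sqrt (r ^ 4 - b ^ 4) / Real.sqrt (r ^ 2 - b ^ 2 * m)) b :=
    ContinuousAt.div (by fun_prop) (by fun_prop) (Real.sqrt_pos.2 hDb).ne'
  refine ⟨fun r hr => ?_, fun r hr => ?_, ?_, ?_⟩
  · have hr0 : 0 < r := hb.trans hr
    obtain ⟨h1, h2⟩ := hpos r hr
    rw [hR r hr, hte]
    refine (((eh_tot b m r hb hm0 hm1 hr).const_mul _).const_add _).congr_deriv ?_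
    field_simp
  · have hr0 : 0 < r := hb.trans hr
    obtain ⟨h1, h2⟩ := hpos r hr
    rw [hR r hr, hφe]
    refine (((eh_F' b m r hb hm0 hm1 hr).const_mul _).const_add _).congr_deriv ?_
    field_simp
  · have hc : ContinuousAt t b := by
      rw [hte]
      exact continuousAt_const.add (continuousAt_const.mul
        ((cG.sub (continuousAt_const.mul cE)).add (continuousAt_const.mul cF)))
    have hv : t b = t₁ := by rw [hte]; simp [eh_F0, eh_E0]
    have := hc.tendsto
    rw [hv] at this
    exact this.mono_left nhdsWithin_le_nhds
  · have hc : ContinuousAt φ b := by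
      rw [hφe]
      exact continuousAt_const.add (continuousAt_const.mul cF)
    have hv : φ b = φ₁ := by rw [hφe]; simp [eh_F0]
    have := hc.tendsto
    rw [hv] at this
    exact this.mono_left nhdsWithin_le_nhds
end
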